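/- For every pair of real numbers y < x, both inequalities hold: −y/2 − (F'(x) − F'(y))/(F(x) − F(y)) > 0 and x/2 + (F'(x) − F'(y))/(F(x) − F(y)) > 0. -/

import Mathlib

open Real Filter Finset

/-- The rescaled Gaussian cumulative distribution function
`F(ξ) = (1/(2√π)) ∫_{-∞}^{ξ} e^{-s²/4} ds`. -/
noncomputable def F (x : ℝ) : ℝ :=
  (1 / (2 * Real.sqrt Real.pi)) * ∫ s in Set.Iio x, Real.exp (-s ^ 2 / 4)

/-- The derivative `F'(ξ) = (1/(2√π)) e^{-ξ²/4}`. -/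
noncomputable def F' (x : ℝ) : ℝ :=
  (1 / (2 * Real.sqrt Real.pi)) * Real.exp (-x ^ 2 / 4)

theorem integrable_exp_neg_sq_div_four :
    MeasureTheory.Integrable fun s : ℝ => Real.exp (-s ^ 2 / 4) := by
  convert integrable_exp_neg_mul_sq (b := 1 / 4) (by norm_num) using 3
  ring

theorem F'_pos (x : ℝ) : 0 < F' x := by
  unfold F'
  positivity

theorem hasDerivAt_F (x : ℝ) : HasDerivAt F (F' x) x := by
  have hcont : Continuous fun s : ℝ => Real.exp (-s ^ 2 / 4) := by fun_prop
  have hint := integrable_exp_neg_sq_div_four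
  have hF : F = fun u : ℝ => (1 / (2 * Real.sqrt Real.pi)) *
      ((∫ s in (0 : ℝ)..u, Real.exp (-s ^ 2 / 4)) +
        ∫ s in Set.Iic (0 : ℝ), Real.exp (-s ^ 2 / 4)) := by
    funext u
    rw [← intervalIntegral.integral_Iic_sub_Iic hint.integrableOn hint.integrableOn,
      sub_add_cancel, MeasureTheory.integral_Iic_eq_integral_Iio, F]
  rw [hF]
  exact ((hcont.integral_hasStrictDerivAt 0 x).hasDerivAt.add_const _).const_mul _

theorem hasDerivAt_F' (x : ℝ) : HasDerivAt F' (-(x / 2) * F' x) x := by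
  have h : HasDerivAt (fun s : ℝ => -s ^ 2 / 4) (-(x / 2)) x := by
    refine ((hasDerivAt_pow 2 x).neg.div_const 4).congr_deriv ?_
    norm_num
    ring
  refine (h.exp.const_mul (1 / (2 * Real.sqrt Real.pi))).congr_deriv ?_
  unfold F'
  ring

theorem strictMono_F : StrictMono F :=
  strictMono_of_hasDerivAt_pos hasDerivAt_F F'_pos

/-- Cauchy's mean value theorem for `F'` and `F`. -/
theorem exists_div_sub_eq_neg_half {x y : ℝ} (hyx : y < x) :
    ∃ c ∈ Set.Ioo y x, (F' x - F' y) / (F x - F y) = -(c / 2) := by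
  obtain ⟨c, hc, h⟩ := exists_ratio_hasDerivAt_eq_ratio_slope F' (fun s => -(s / 2) * F' s) hyx
    (fun s _ => (hasDerivAt_F' s).continuousAt.continuousWithinAt)
    (fun s _ => hasDerivAt_F' s) F F'
    (fun s _ => (hasDerivAt_F s).continuousAt.continuousWithinAt)
    (fun s _ => hasDerivAt_F s)
  refine ⟨c, hc, ?_⟩
  rw [div_eq_iff (sub_pos.2 (strictMono_F hyx)).ne']
  apply mul_right_cancel₀ (F'_pos c).ne'
  linarith

/-- For all `y < x`: `−y/2 − (F'(x) − F'(y))/(F(x) − F(y)) > 0` and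
`x/2 + (F'(x) − F'(y))/(F(x) − F(y)) > 0`. -/
theorem stmt12 (x y : ℝ) (hyx : y < x) :
    0 < -y / 2 - (F' x - F' y) / (F x - F y) ∧
    0 < x / 2 + (F' x - F' y) / (F x - F y) := by
  obtain ⟨c, ⟨hyc, hcx⟩, h⟩ := exists_div_sub_eq_neg_half hyx
  rw [h]
  constructor <;> linarith
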